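/- Let Φ be a finite based root system and let (Φ, α ↦ −α, d) be an OMRS on (Φ, Φ⁺). Then the topes of (Φ, α ↦ −α, d) are precisely the sets w·Φ⁺ for w ∈ W; these sets are pairwise distinct for distinct w ∈ W, so the number of topes equals |W|. -/

import Mathlib

open Set Pointwise

variable {V : Type*} [AddCommGroup V] [Module ℝ V]

/-- `cone X` is the set of all finite nonnegative linear combinations of elements of `X`. -/
def cone (X : Set V) : Set V :=
  {v | ∃ (n : ℕ) (c : Fin n → ℝ) (x : Fin n → V),
    (∀ i, 0 ≤ c i) ∧ (∀ i, x i ∈ X) ∧ v = ∑ i, c i • x i}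

/-- An oriented matroid structure on the ground set `E ⊆ V`, with involution `x ↦ -x`
and closure operator `d` (only its values on subsets of `E` are relevant). -/
structure IsOrientedMatroidOn (E : Set V) (d : Set V → Set V) : Prop where
  neg_mem : ∀ x ∈ E, -x ∈ E
  neg_ne : ∀ x ∈ E, -x ≠ x
  cx_le_ground : ∀ X, X ⊆ E → d X ⊆ E
  le_cx : ∀ X, X ⊆ E → X ⊆ d X
  cx_mono : ∀ X Y : Set V, X ⊆ Y → Y ⊆ E → d X ⊆ d Y
  cx_idem : ∀ X, X ⊆ E → d (d X) = d X
  cx_neg : ∀ X, X ⊆ E → d (-X) = -(d X)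
  exchange2 : ∀ X, X ⊆ E → ∀ x ∈ E, x ∈ d (X ∪ {-x}) → x ∈ d X
  exchange3 : ∀ X, X ⊆ E → ∀ x ∈ E, ∀ y ∈ E,
    x ∈ d (X ∪ {-y}) → x ∉ d X → y ∈ d ((X \ {y}) ∪ {-x})
  finitary : ∀ X, X ⊆ E → ∀ x ∈ d X, ∃ Y, Y ⊆ X ∧ Y.Finite ∧ x ∈ d Y

/-- The oriented matroid is reduced: `d ∅ = ∅` and `d {x} = {x}` for `x ∈ E`. -/
def IsReducedOn (E : Set V) (d : Set V → Set V) : Prop :=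
  d ∅ = ∅ ∧ ∀ x ∈ E, d {x} = {x}

/-- A tope: a maximal `d`-closed asymmetric subset of `E`. -/
def IsTope (E : Set V) (d : Set V → Set V) (R : Set V) : Prop :=
  R ⊆ E ∧ d R ⊆ R ∧ (∀ x ∈ R, -x ∉ R) ∧
    ∀ R' : Set V, R' ⊆ E → d R' ⊆ R' → (∀ x ∈ R', -x ∉ R') → R ⊆ R' → R' = R

/-- The simple reflections `s_α : v ↦ v - 2B(v,α)α` for `α ∈ Δ`. -/
def simpleReflections (B : LinearMap.BilinForm ℝ V) (Δ : Set V) : Set (V ≃ₗ[ℝ] V) :=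
  {g | ∃ α ∈ Δ, ∀ v : V, g v = v - (2 * B v α) • α}

/-- The Weyl group generated by the simple reflections. -/
def weylGroup (B : LinearMap.BilinForm ℝ V) (Δ : Set V) : Subgroup (V ≃ₗ[ℝ] V) :=
  Subgroup.closure (simpleReflections B Δ)

/-- The root system `Φ = W·Δ`. -/
def rootSystem (B : LinearMap.BilinForm ℝ V) (Δ : Set V) : Set V :=
  {v | ∃ w ∈ weylGroup B Δ, ∃ α ∈ Δ, v = w α}

/-- The positive roots `Φ⁺ = Φ ∩ cone(Δ)`. -/
def positiveRoots (B : LinearMap.BilinForm ℝ V) (Δ : Set V) : Set V :=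
  rootSystem B Δ ∩ cone Δ

/-- A based root system with simple roots `Δ` and symmetric bilinear form `B`. -/
structure IsBasedRootSystem (B : LinearMap.BilinForm ℝ V) (Δ : Set V) : Prop where
  finite : Δ.Finite
  indep : LinearIndependent ℝ ((↑) : Δ → V)
  symm : ∀ u v : V, B u v = B v u
  diag_one : ∀ α ∈ Δ, B α α = 1
  offdiag : ∀ α ∈ Δ, ∀ β ∈ Δ, α ≠ β →
    (∃ m : ℕ, 2 ≤ m ∧ B α β = -Real.cos (Real.pi / (m : ℝ))) ∨ B α β ≤ -1

/-- An oriented matroid root system (OMRS) on `(Φ, Φ⁺)`. -/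
structure IsOMRS (B : LinearMap.BilinForm ℝ V) (Δ : Set V) (d : Set V → Set V) : Prop where
  om : IsOrientedMatroidOn (rootSystem B Δ) d
  reduced : IsReducedOn (rootSystem B Δ) d
  equivariant : ∀ w ∈ weylGroup B Δ, ∀ X, X ⊆ rootSystem B Δ → d (⇑w '' X) = ⇑w '' d X
  positive_closed : d (positiveRoots B Δ) = positiveRoots B Δ
  rank_two : ∀ X, X ⊆ rootSystem B Δ →
    Module.rank ℝ ↥(Submodule.span ℝ X) ≤ 2 → d X = cone X ∩ rootSystem B Δ

/-- `A` is `c₂`-closed in `P`. -/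
def C2Closed (P A : Set V) : Prop :=
  ∀ α ∈ A, ∀ β ∈ A, ∀ γ ∈ P, γ ∈ cone {α, β} → γ ∈ A

/-- `A` is `c₂`-biclosed in `P`. -/
def C2Biclosed (P A : Set V) : Prop :=
  C2Closed P A ∧ C2Closed P (P \ A)

/-- A root system is clean if every `c₂`-biclosed set of positive roots gives a tope of
the RRS oriented matroid `(Φ, -, cone_Φ)`. -/
def IsClean (B : LinearMap.BilinForm ℝ V) (Δ : Set V) : Prop :=
  ∀ A, A ⊆ positiveRoots B Δ → C2Biclosed (positiveRoots B Δ) A →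
    IsTope (rootSystem B Δ) (fun X => cone X ∩ rootSystem B Δ)
      (A ∪ (-(positiveRoots B Δ \ A)))

/-! ### Cones -/

theorem cone_add_mem {X : Set V} {u v : V} (hu : u ∈ cone X) (hv : v ∈ cone X) :
    u + v ∈ cone X := by
  obtain ⟨n, c, x, hc, hx, rfl⟩ := hu
  obtain ⟨m, c', x', hc', hx', rfl⟩ := hv
  refine ⟨n + m, Fin.append c c', Fin.append x x', ?_, ?_, ?_⟩
  · intro i
    refine Fin.addCases (fun i => ?_) (fun i => ?_) i <;> simp [hc, hc']
  · intro i
    refine Fin.addCases (fun i => ?_) (fun i => ?_) i <;> simp [hx, hx']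
  · simp [Fin.sum_univ_add]

theorem cone_smul_mem {X : Set V} {u : V} (hu : u ∈ cone X) {p : ℝ} (hp : 0 ≤ p) :
    p • u ∈ cone X := by
  obtain ⟨n, c, x, hc, hx, rfl⟩ := hu
  exact ⟨n, fun i => p * c i, x, fun i => mul_nonneg hp (hc i), hx, by
    simp [Finset.smul_sum, mul_smul]⟩

theorem subset_cone (X : Set V) : X ⊆ cone X := fun x hx =>
  ⟨1, fun _ => 1, fun _ => x, by simp, by simpa using hx, by simp⟩

theorem zero_mem_cone (X : Set V) : (0 : V) ∈ cone X :=
  ⟨0, fun _ => 0, fun _ => 0, by simp, fun i => i.elim0, by simp⟩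

theorem sum_mem_cone {X : Set V} {ι : Type*} (s : Finset ι) (f : ι → V)
    (h : ∀ i ∈ s, f i ∈ cone X) : ∑ i ∈ s, f i ∈ cone X := by
  classical
  induction s using Finset.induction_on with
  | empty => simpa using zero_mem_cone X
  | insert i s hi ih =>
    rw [Finset.sum_insert hi]
    exact cone_add_mem (h _ (by simp)) (ih fun j hj => h _ (by simp [hj]))

theorem cone_sub_span (X : Set V) : cone X ⊆ Submodule.span ℝ X := by
  rintro v ⟨n, c, x, hc, hx, rfl⟩
  exact Submodule.sum_mem _ fun i _ => Submodule.smul_mem _ _ (Submodule.subset_span (hx i))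

/-- Dual functionals of a linearly independent set. -/
theorem exists_dual {Δ : Set V} (h : LinearIndependent ℝ ((↑) : Δ → V)) :
    ∃ f : V → V →ₗ[ℝ] ℝ, ∀ α ∈ Δ, f α α = 1 ∧ ∀ β ∈ Δ, β ≠ α → f α β = 0 := by
  classical
  have hs : LinearIndepOn ℝ id Δ := h
  let b := Module.Basis.extend hs
  refine ⟨fun α => if hα : α ∈ Δ then b.coord ⟨α, hs.subset_extend _ hα⟩ else 0, ?_⟩
  intro α hα
  have key : ∀ β (hβ : β ∈ Δ), b ⟨β, hs.subset_extend _ hβ⟩ = β := fun β hβ =>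
    Module.Basis.extend_apply_self hs _
  refine ⟨?_, fun β hβ hne => ?_⟩
  · simp only [hα, dif_pos]
    have h2 : b.coord ⟨α, hs.subset_extend _ hα⟩ (b ⟨α, hs.subset_extend _ hα⟩) = 1 := by simp
    rwa [key α hα] at h2
  · simp only [hα, dif_pos]
    rw [← key β hβ]
    simp only [Module.Basis.coord_apply, Module.Basis.repr_self]
    rw [Finsupp.single_apply, if_neg]
    simpa using hne

theorem dual_nonneg {Δ : Set V} {f : V → V →ₗ[ℝ] ℝ}
    (hf : ∀ α ∈ Δ, f α α = 1 ∧ ∀ β ∈ Δ, β ≠ α → f α β = 0) {v : V} (hv : v ∈ cone Δ)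
    {α : V} (hα : α ∈ Δ) : 0 ≤ f α v := by
  obtain ⟨n, c, x, hc, hx, rfl⟩ := hv
  rw [map_sum]
  refine Finset.sum_nonneg fun i _ => ?_
  rw [map_smul, smul_eq_mul]
  refine mul_nonneg (hc i) ?_
  by_cases h : x i = α
  · rw [h, (hf α hα).1]; norm_num
  · rw [(hf α hα).2 _ (hx i) h]

theorem dual_sum {Δ : Set V} (hfin : Δ.Finite) {f : V → V →ₗ[ℝ] ℝ}
    (hf : ∀ α ∈ Δ, f α α = 1 ∧ ∀ β ∈ Δ, β ≠ α → f α β = 0) {v : V}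
    (hv : v ∈ Submodule.span ℝ Δ) : v = ∑ α ∈ hfin.toFinset, f α v • α := by
  classical
  induction hv using Submodule.span_induction with
  | mem x hx =>
    rw [Finset.sum_eq_single x]
    · rw [(hf x hx).1, one_smul]
    · intro b hb hne
      rw [(hf b (by simpa using hb)).2 x hx hne.symm, zero_smul]
    · intro h; simp [hx] at h
  | zero => simp
  | add x y _ _ hx hy =>
    simp only [map_add, add_smul, Finset.sum_add_distrib, ← hx, ← hy]
  | smul a x _ hx =>
    simp only [map_smul, smul_eq_mul, mul_smul, ← Finset.smul_sum, ← hx]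

theorem mem_cone_of_dual {Δ : Set V} (hfin : Δ.Finite) {f : V → V →ₗ[ℝ] ℝ}
    (hf : ∀ α ∈ Δ, f α α = 1 ∧ ∀ β ∈ Δ, β ≠ α → f α β = 0) {v : V}
    (hv : v ∈ Submodule.span ℝ Δ) (h : ∀ α ∈ Δ, 0 ≤ f α v) : v ∈ cone Δ := by
  rw [dual_sum hfin hf hv]
  refine sum_mem_cone _ _ fun α hα => ?_
  have hα : α ∈ Δ := by simpa using hα
  exact cone_smul_mem (subset_cone _ hα) (h α hα)

/-- The cone over a linearly independent set is salient. -/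
theorem cone_salient {Δ : Set V} (hfin : Δ.Finite)
    (h : LinearIndependent ℝ ((↑) : Δ → V)) {v : V}
    (hv : v ∈ cone Δ) (hv' : -v ∈ cone Δ) : v = 0 := by
  obtain ⟨f, hf⟩ := exists_dual h
  rw [dual_sum hfin hf (cone_sub_span _ hv)]
  refine Finset.sum_eq_zero fun α hα => ?_
  have hα : α ∈ Δ := by simpa using hα
  have h1 := dual_nonneg hf hv hα
  have h2 := dual_nonneg hf hv' hα
  rw [map_neg] at h2
  rw [show f α v = 0 by linarith, zero_smul]

/-! ### Reflections -/

open Classical in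
/-- The reflection in a unit vector. -/
noncomputable def sr (B : LinearMap.BilinForm ℝ V) (α : V) : V ≃ₗ[ℝ] V :=
  if h : ((2 : ℝ) • B α) α = 2 then Module.reflection h else 1

theorem sr_apply {B : LinearMap.BilinForm ℝ V} (hs : ∀ u v : V, B u v = B v u) {α : V}
    (h : B α α = 1) (v : V) : sr B α v = v - (2 * B v α) • α := by
  have h' : ((2 : ℝ) • B α) α = 2 := by simp [h]
  rw [sr, dif_pos h', Module.reflection_apply, hs v α]
  simp

theorem sr_self {B : LinearMap.BilinForm ℝ V} (hs : ∀ u v : V, B u v = B v u) {α : V}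
    (h : B α α = 1) : sr B α α = -α := by
  rw [sr_apply hs h, h, mul_one, two_smul]; abel

theorem sr_mul_self {B : LinearMap.BilinForm ℝ V} (hs : ∀ u v : V, B u v = B v u) {α : V}
    (h : B α α = 1) : sr B α * sr B α = 1 := by
  ext v
  simp only [LinearEquiv.mul_apply, LinearEquiv.coe_one, id]
  rw [sr_apply hs h v, map_sub, map_smul, sr_self hs h, sr_apply hs h v]
  simp

theorem sr_isom {B : LinearMap.BilinForm ℝ V} (hs : ∀ u v : V, B u v = B v u) {α : V}
    (h : B α α = 1) (u v : V) : B (sr B α u) (sr B α v) = B u v := by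
  rw [sr_apply hs h, sr_apply hs h]
  simp only [map_sub, map_smul, LinearMap.sub_apply, LinearMap.smul_apply, smul_eq_mul, h,
    hs α v]
  ring

/-! ### Dihedral computations -/

/-- The numbers `sin (n θ) / sin θ` for `c = cos θ`. -/
def useq (c : ℝ) : ℕ → ℝ
  | 0 => 0
  | 1 => 1
  | n + 2 => 2 * c * useq c (n + 1) - useq c n

theorem useq_cos (θ : ℝ) (n : ℕ) : useq (Real.cos θ) n * Real.sin θ = Real.sin (n * θ) := by
  induction n using Nat.twoStepInduction with
  | zero => simp [useq]
  | one => simp [useq]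
  | more n h1 h2 =>
    rw [useq, sub_mul, mul_assoc, h1, h2]
    push_cast
    have e1 : ((n : ℝ) + 2) * θ = ((n : ℝ) + 1) * θ + θ := by ring
    have e2 : (n : ℝ) * θ = ((n : ℝ) + 1) * θ - θ := by ring
    rw [e1, e2, Real.sin_add, Real.sin_sub]
    ring

theorem useq_ge (c : ℝ) (hc : 1 ≤ c) (n : ℕ) : 0 ≤ useq c n ∧ useq c n ≤ useq c (n + 1) := by
  induction n with
  | zero => simp [useq]
  | succ n ih =>
    refine ⟨ih.1.trans ih.2, ?_⟩
    rw [useq]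
    nlinarith [ih.1, ih.2]

/-- Alternating word of length `n` whose last letter is `b`. -/
def altw {G : Type*} [Group G] : G → G → ℕ → G
  | _, _, 0 => 1
  | a, b, n + 1 => altw b a n * b

theorem altw_mem {G : Type*} [Group G] (a b : G) (n : ℕ) :
    altw a b n ∈ ({1, a, b} : Set G) ^ n := by
  induction n generalizing a b with
  | zero => simp [altw]
  | succ n ih =>
    rw [altw, pow_succ]
    refine Set.mul_mem_mul ?_ (by simp)
    have := ih b a
    rwa [Set.pair_comm b a] at this

theorem altw_of_mem {G : Type*} [Group G] (a b : G) (ha : a * a = 1) (hb : b * b = 1) (n : ℕ)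
    {x : G} (hx : x ∈ ({1, a, b} : Set G) ^ n) :
    ∃ j ≤ n, x = altw a b j ∨ x = altw b a j := by
  have key : ∀ (a b : G), b * b = 1 → ∀ j, ∃ i ≤ j + 1,
      altw a b j * b = altw a b i ∨ altw a b j * b = altw b a i := by
    intro a b hb j
    cases j with
    | zero => exact ⟨1, le_rfl, Or.inl (by simp [altw])⟩
    | succ j => exact ⟨j, by omega, Or.inr (by rw [altw, mul_assoc, hb, mul_one])⟩
  induction n generalizing x with
  | zero => exact ⟨0, le_rfl, Or.inl (by simpa [altw] using hx)⟩
  | succ n ih =>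
    rw [pow_succ] at hx
    obtain ⟨y, hy, g, hg, rfl⟩ := Set.mem_mul.1 hx
    obtain ⟨j, hj, hyj⟩ := ih hy
    rcases hg with rfl | rfl | rfl
    · exact ⟨j, by omega, by simpa using hyj⟩
    · rcases hyj with rfl | rfl
      · exact ⟨j + 1, by omega, Or.inr rfl⟩
      · obtain ⟨i, hi, h⟩ := key b g ha j
        exact ⟨i, by omega, h.symm⟩
    · rcases hyj with rfl | rfl
      · obtain ⟨i, hi, h⟩ := key a g hb j
        exact ⟨i, by omega, h⟩
      · exact ⟨j + 1, by omega, Or.inl rfl⟩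

theorem altw_add {G : Type*} [Group G] (a b : G) (i m : ℕ) :
    ∃ z ∈ ({1, a, b} : Set G) ^ i, altw a b (i + m) = z * altw a b m := by
  induction m generalizing a b with
  | zero => exact ⟨altw a b i, altw_mem a b i, by simp [altw]⟩
  | succ m ih =>
    obtain ⟨z, hz, h⟩ := ih b a
    refine ⟨z, ?_, ?_⟩
    · rwa [Set.pair_comm b a] at hz
    · rw [← add_assoc, altw, h, altw, mul_assoc]

/-- Coefficients. -/
noncomputable def pco (c : ℝ) (j : ℕ) : ℝ := if Even j then useq c (j + 1) else useq c j
/-- Coefficients. -/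
noncomputable def qco (c : ℝ) (j : ℕ) : ℝ := if Even j then useq c j else useq c (j + 1)

theorem altw_root {B : LinearMap.BilinForm ℝ V} (hs : ∀ u v : V, B u v = B v u) {c : ℝ} (j : ℕ) :
    ∀ α β : V, B α α = 1 → B β β = 1 → B α β = -c →
      altw (sr B α) (sr B β) j α = pco c j • α + qco c j • β := by
  induction j using Nat.twoStepInduction with
  | zero => intro α β _ _ _; simp [altw, pco, qco, useq]
  | one =>
    intro α β h1 h2 h3
    simp only [altw, one_mul]
    rw [sr_apply hs h2, h3]
    simp [pco, qco, useq]
  | more j ih1 ih2 =>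
    intro α β h1 h2 h3
    have h3' : B β α = -c := by rw [hs, h3]
    have e1 : sr B β α = α + (2 * c) • β := by
      rw [sr_apply hs h2, h3]; simp
    rw [altw, LinearEquiv.mul_apply, e1, map_add, map_smul, ih2 β α h2 h1 h3', altw,
      LinearEquiv.mul_apply, sr_self hs h1, map_neg, ih1 α β h1 h2 h3]
    have p : pco c (j + 2) = - pco c j + 2 * c * qco c (j + 1) := by
      by_cases h : Even j <;> simp [pco, qco, useq, Nat.even_add_one, h] <;> ring
    have q : qco c (j + 2) = - qco c j + 2 * c * pco c (j + 1) := by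
      by_cases h : Even j <;> simp [pco, qco, useq, Nat.even_add_one, h] <;> ring
    rw [p, q]
    module

theorem altw_perp {B : LinearMap.BilinForm ℝ V} (hs : ∀ u v : V, B u v = B v u) (j : ℕ) :
    ∀ α β v : V, B α α = 1 → B β β = 1 → B v α = 0 → B v β = 0 →
      altw (sr B α) (sr B β) j v = v := by
  induction j with
  | zero => intro α β v _ _ _ _; simp [altw]
  | succ j ih =>
    intro α β v h1 h2 h3 h4
    rw [altw, LinearEquiv.mul_apply, sr_apply hs h2, h4]
    simpa using ih β α v h2 h1 h4 h3

theorem useq_cos_nonneg {m : ℕ} (hm : 2 ≤ m) {n : ℕ} (hn : n ≤ m) :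
    0 ≤ useq (Real.cos (Real.pi / m)) n := by
  have hm0 : (0 : ℝ) < m := by positivity
  have hm2 : (2 : ℝ) ≤ m := by exact_mod_cast hm
  have hsin : 0 < Real.sin (Real.pi / m) :=
    Real.sin_pos_of_pos_of_lt_pi (by positivity)
      (by rw [div_lt_iff₀ hm0]; nlinarith [Real.pi_pos])
  have h := useq_cos (Real.pi / m) n
  have h2 : 0 ≤ Real.sin (n * (Real.pi / m)) := by
    apply Real.sin_nonneg_of_nonneg_of_le_pi (by positivity)
    have : (n : ℝ) ≤ m := by exact_mod_cast hn
    rw [← mul_div_assoc, div_le_iff₀ hm0]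
    nlinarith [Real.pi_pos]
  rw [← h] at h2
  exact nonneg_of_mul_nonneg_left h2 hsin

theorem braid {B : LinearMap.BilinForm ℝ V} (hs : ∀ u v : V, B u v = B v u) {m : ℕ}
    (hm : 2 ≤ m) {α β : V} (h1 : B α α = 1) (h2 : B β β = 1)
    (h3 : B α β = -Real.cos (Real.pi / m)) :
    altw (sr B α) (sr B β) m = altw (sr B β) (sr B α) m := by
  have hm0 : (0 : ℝ) < m := by positivity
  have hm2 : (2 : ℝ) ≤ m := by exact_mod_cast hm
  have hsin : 0 < Real.sin (Real.pi / m) :=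
    Real.sin_pos_of_pos_of_lt_pi (by positivity)
      (by rw [div_lt_iff₀ hm0]; nlinarith [Real.pi_pos])
  set c := Real.cos (Real.pi / m) with hc
  have um : useq c m = 0 := by
    have h := useq_cos (Real.pi / m) m
    rw [mul_div_cancel₀ _ hm0.ne', Real.sin_pi] at h
    exact (mul_eq_zero.1 h).resolve_right hsin.ne'
  have um1 : useq c (m + 1) = -1 := by
    have h := useq_cos (Real.pi / m) (m + 1)
    push_cast at h
    rw [add_mul, mul_div_cancel₀ _ hm0.ne', one_mul, add_comm Real.pi, Real.sin_add_pi] at h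
    have : (useq c (m + 1) + 1) * Real.sin (Real.pi / m) = 0 := by rw [add_mul, h]; ring
    have := (mul_eq_zero.1 this).resolve_right hsin.ne'
    linarith
  obtain ⟨k, rfl⟩ : ∃ k, m = k + 1 := ⟨m - 1, by omega⟩
  have uk : useq c k = 1 := by
    have : useq c (k + 2) = 2 * c * useq c (k + 1) - useq c k := rfl
    rw [show k + 1 + 1 = k + 2 from rfl] at um1
    rw [um, um1] at this
    linarith
  have main : ∀ α β : V, B α α = 1 → B β β = 1 → B α β = -c →
      altw (sr B α) (sr B β) (k + 1) α = altw (sr B β) (sr B α) (k + 1) α := by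
    intro α β h1 h2 h3
    rw [altw_root hs (k + 1) α β h1 h2 h3]
    rw [altw, LinearEquiv.mul_apply, sr_self hs h1, map_neg, altw_root hs k α β h1 h2 h3]
    by_cases h : Even k <;>
      simp [pco, qco, Nat.even_add_one, h, um, um1, uk]
  have hA := main α β h1 h2 h3
  have hB := main β α h2 h1 (by rw [hs, h3])
  have hdet : 1 - c ^ 2 ≠ 0 := by
    have := Real.sin_sq_add_cos_sq (Real.pi / ((k + 1 : ℕ) : ℝ))
    rw [← hc] at this
    have : 1 - c ^ 2 = Real.sin (Real.pi / ((k + 1 : ℕ) : ℝ)) ^ 2 := by linarith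
    rw [this]; positivity
  ext v
  set p := (B v α + c * B v β) / (1 - c ^ 2) with hp
  set q := (B v β + c * B v α) / (1 - c ^ 2) with hq
  set u := v - p • α - q • β with hu
  have h3' : B β α = -c := by rw [hs, h3]
  have hua : B u α = 0 := by
    simp only [hu, map_sub, map_smul, LinearMap.sub_apply, LinearMap.smul_apply, smul_eq_mul, h1,
      h3', hp, hq]
    field_simp
    ring
  have hub : B u β = 0 := by
    simp only [hu, map_sub, map_smul, LinearMap.sub_apply, LinearMap.smul_apply, smul_eq_mul, h2,
      h3, hp, hq]
    field_simp
    ring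
  have hv : v = u + p • α + q • β := by rw [hu]; abel
  rw [hv]
  simp only [map_add, map_smul, hA, hB, altw_perp hs _ α β u h1 h2 hua hub,
    altw_perp hs _ β α u h2 h1 hub hua]

theorem dihedral_claim {B : LinearMap.BilinForm ℝ V} (hs : ∀ u v : V, B u v = B v u)
    {α β : V} (h1 : B α α = 1) (h2 : B β β = 1)
    (h3 : (∃ m : ℕ, 2 ≤ m ∧ B α β = -Real.cos (Real.pi / (m : ℝ))) ∨ B α β ≤ -1)
    (k : ℕ) {x : V ≃ₗ[ℝ] V} (hx : x ∈ ({1, sr B α, sr B β} : Set (V ≃ₗ[ℝ] V)) ^ k) :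
    (∃ p q : ℝ, 0 ≤ p ∧ 0 ≤ q ∧ x α = p • α + q • β) ∨
    (∃ k', k = k' + 1 ∧ x * sr B α ∈ ({1, sr B α, sr B β} : Set (V ≃ₗ[ℝ] V)) ^ k') := by
  have ha := sr_mul_self hs h1
  have hb := sr_mul_self hs h2
  have hone : (1 : V ≃ₗ[ℝ] V) ∈ ({1, sr B α, sr B β} : Set (V ≃ₗ[ℝ] V)) := by simp
  have endA : ∀ j ≤ k, x = altw (sr B β) (sr B α) j → 1 ≤ j →
      (∃ k', k = k' + 1 ∧ x * sr B α ∈ ({1, sr B α, sr B β} : Set (V ≃ₗ[ℝ] V)) ^ k') := by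
    intro j hj hxj hj1
    obtain ⟨i, rfl⟩ : ∃ i, j = i + 1 := ⟨j - 1, by omega⟩
    refine ⟨k - 1, by omega, ?_⟩
    rw [hxj, altw, mul_assoc, ha, mul_one]
    exact Set.pow_subset_pow_right hone (by omega : i ≤ k - 1) (altw_mem _ _ _)
  obtain ⟨j, hj, hxj⟩ := altw_of_mem _ _ ha hb k hx
  have posB : ∀ c : ℝ, B α β = -c → x = altw (sr B α) (sr B β) j → 0 ≤ useq c j →
      0 ≤ useq c (j + 1) → ∃ p q : ℝ, 0 ≤ p ∧ 0 ≤ q ∧ x α = p • α + q • β := by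
    intro c hc hxj hu hu'
    refine ⟨pco c j, qco c j, ?_, ?_, by rw [hxj, altw_root hs j α β h1 h2 hc]⟩
    · unfold pco; split_ifs <;> assumption
    · unfold qco; split_ifs <;> assumption
  rcases hxj with hxj | hxj
  · rcases h3 with ⟨m, hm, h3⟩ | h3
    · by_cases hjm : j < m
      · exact Or.inl (posB _ h3 hxj (useq_cos_nonneg hm (by omega)) (useq_cos_nonneg hm (by omega)))
      · right
        obtain ⟨i, rfl⟩ : ∃ i, j = i + m := ⟨j - m, by omega⟩
        obtain ⟨z, hz, hzz⟩ := altw_add (sr B α) (sr B β) i m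
        obtain ⟨l, rfl⟩ : ∃ l, m = l + 1 := ⟨m - 1, by omega⟩
        refine ⟨k - 1, by omega, ?_⟩
        rw [hxj, hzz, braid hs hm h1 h2 h3, altw, mul_assoc, mul_assoc, ha, mul_one]
        refine Set.pow_subset_pow_right hone (by omega : i + l ≤ k - 1) ?_
        rw [pow_add]
        exact Set.mul_mem_mul hz (altw_mem _ _ _)
    · exact Or.inl (posB (-B α β) (by ring) hxj (useq_ge _ (by linarith) _).1
        (useq_ge _ (by linarith) _).1)
  · rcases Nat.eq_zero_or_pos j with rfl | hj1
    · left
      exact ⟨1, 0, by norm_num, le_rfl, by rw [hxj]; simp [altw]⟩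
    · exact Or.inr (endA j hj hxj hj1)

/-! ### The Weyl group and its roots -/

/-- Elements which are products of at most `n` simple reflections. -/
def Lset (B : LinearMap.BilinForm ℝ V) (Δ : Set V) (n : ℕ) : Set (V ≃ₗ[ℝ] V) :=
  (insert 1 (sr B '' Δ)) ^ n

theorem simpleReflections_eq {B : LinearMap.BilinForm ℝ V} {Δ : Set V}
    (hb : IsBasedRootSystem B Δ) : simpleReflections B Δ = sr B '' Δ := by
  ext g
  constructor
  · rintro ⟨α, hα, h⟩
    refine ⟨α, hα, ?_⟩
    ext v
    rw [h, sr_apply hb.symm (hb.diag_one α hα)]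
  · rintro ⟨α, hα, rfl⟩
    exact ⟨α, hα, fun v => sr_apply hb.symm (hb.diag_one α hα) v⟩

theorem sr_mem_weyl {B : LinearMap.BilinForm ℝ V} {Δ : Set V}
    (hb : IsBasedRootSystem B Δ) {α : V} (hα : α ∈ Δ) : sr B α ∈ weylGroup B Δ :=
  Subgroup.subset_closure (by rw [simpleReflections_eq hb]; exact ⟨α, hα, rfl⟩)

theorem Lset_mono (B : LinearMap.BilinForm ℝ V) (Δ : Set V) {m n : ℕ} (h : m ≤ n) :
    Lset B Δ m ⊆ Lset B Δ n := Set.pow_subset_pow_right (by simp) h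

theorem exists_Lset {B : LinearMap.BilinForm ℝ V} {Δ : Set V}
    (hb : IsBasedRootSystem B Δ) {w : V ≃ₗ[ℝ] V} (hw : w ∈ weylGroup B Δ) :
    ∃ n, w ∈ Lset B Δ n := by
  unfold weylGroup at hw
  rw [simpleReflections_eq hb] at hw
  induction hw using Subgroup.closure_induction_right with
  | one => exact ⟨0, by simp [Lset]⟩
  | mul_right x hx y hy ih =>
    obtain ⟨n, hn⟩ := ih
    exact ⟨n + 1, by rw [Lset, pow_succ]; exact Set.mul_mem_mul hn (Or.inr hy)⟩
  | mul_inv_cancel x hx y hy ih =>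
    obtain ⟨n, hn⟩ := ih
    obtain ⟨α, hα, rfl⟩ := hy
    have : (sr B α)⁻¹ = sr B α :=
      inv_eq_of_mul_eq_one_left (sr_mul_self hb.symm (hb.diag_one α hα))
    rw [this]
    exact ⟨n + 1, by rw [Lset, pow_succ]; exact Set.mul_mem_mul hn (Or.inr ⟨α, hα, rfl⟩)⟩

theorem weyl_induction {B : LinearMap.BilinForm ℝ V} {Δ : Set V}
    (hb : IsBasedRootSystem B Δ) (P : (V ≃ₗ[ℝ] V) → Prop) (h1 : P 1)
    (hm : ∀ w, P w → ∀ α ∈ Δ, P (w * sr B α)) {w : V ≃ₗ[ℝ] V} (hw : w ∈ weylGroup B Δ) :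
    P w := by
  obtain ⟨n, hn⟩ := exists_Lset hb hw
  clear hw
  induction n generalizing w with
  | zero =>
    have : w = 1 := by simpa [Lset] using hn
    rwa [this]
  | succ n ih =>
    rw [Lset, pow_succ] at hn
    obtain ⟨u, hu, g, hg, rfl⟩ := Set.mem_mul.1 hn
    rcases hg with rfl | ⟨α, hα, rfl⟩
    · simpa using ih hu
    · exact hm _ (ih hu) α hα

theorem main_claim {B : LinearMap.BilinForm ℝ V} {Δ : Set V}
    (hb : IsBasedRootSystem B Δ) (n : ℕ) : ∀ w ∈ Lset B Δ n, ∀ α ∈ Δ,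
      w α ∈ cone Δ ∨ ∃ n', n = n' + 1 ∧ w * sr B α ∈ Lset B Δ n' := by
  classical
  induction n using Nat.strong_induction_on with
  | _ n ih =>
  intro w hw α hα
  rcases n with _ | N
  · left
    have : w = 1 := by simpa [Lset] using hw
    rw [this]
    exact subset_cone _ hα
  have hw' := hw
  rw [Lset, pow_succ] at hw'
  obtain ⟨u, hu, g, hg, hug⟩ := Set.mem_mul.1 hw'
  rcases hg with rfl | ⟨β, hβ, rfl⟩
  · rw [mul_one] at hug
    subst hug
    rcases ih N (by omega) u hu α hα with h | ⟨n', h, h'⟩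
    · exact Or.inl h
    · exact Or.inr ⟨N, rfl, Lset_mono B Δ (by omega) h'⟩
  have ha := hb.diag_one α hα
  have hbb := hb.diag_one β hβ
  have haa := sr_mul_self hb.symm ha
  have hbb' := sr_mul_self hb.symm hbb
  by_cases hab : α = β
  · subst hab
    right
    refine ⟨N, rfl, ?_⟩
    rw [← hug, mul_assoc, haa, mul_one]
    exact hu
  let D : Set (V ≃ₗ[ℝ] V) := {1, sr B α, sr B β}
  have hDL : ∀ k, D ^ k ⊆ Lset B Δ k := fun k => by
    refine Set.pow_subset_pow_left ?_
    rintro x (rfl | rfl | rfl)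
    · simp
    · exact Or.inr ⟨α, hα, rfl⟩
    · exact Or.inr ⟨β, hβ, rfl⟩
  let P : ℕ → Prop := fun k => ∃ v ∈ Lset B Δ (N + 1 - k), ∃ x ∈ D ^ k, w = v * x
  have hP1 : P 1 := ⟨u, by simpa [Lset] using hu, sr B β, by simp [D], hug.symm⟩
  set k := Nat.findGreatest P (N + 1) with hk
  have hk1 : 1 ≤ k := Nat.le_findGreatest (by omega) hP1
  have hkn : k ≤ N + 1 := Nat.findGreatest_le _
  have hPk : P k := Nat.findGreatest_spec (by omega : 1 ≤ N + 1) hP1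
  have hmax : ∀ j, k < j → j ≤ N + 1 → ¬ P j := fun j => Nat.findGreatest_is_greatest
  obtain ⟨v, hv, x, hx, hvx⟩ := hPk
  have hpos : ∀ γ ∈ Δ, sr B γ ∈ D → v γ ∈ cone Δ := by
    intro γ hγ hγD
    rcases ih (N + 1 - k) (by omega) v hv γ hγ with h | ⟨n', h, h'⟩
    · exact h
    · exfalso
      refine hmax (k + 1) (by omega) (by omega) ⟨v * sr B γ, ?_, sr B γ * x, ?_, ?_⟩
      · rwa [show N + 1 - (k + 1) = n' by omega]
      · rw [pow_succ']
        exact Set.mul_mem_mul hγD hx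
      · rw [mul_assoc, ← mul_assoc (sr B γ), sr_mul_self hb.symm (hb.diag_one γ hγ), one_mul, hvx]
  have hvα := hpos α hα (by simp [D])
  have hvβ := hpos β hβ (by simp [D])
  rcases dihedral_claim hb.symm ha hbb (hb.offdiag α hα β hβ hab) k hx with
    ⟨p, q, hp, hq, h⟩ | ⟨k', hk', h⟩
  · left
    rw [hvx, LinearEquiv.mul_apply, h, map_add, map_smul, map_smul]
    exact cone_add_mem (cone_smul_mem hvα hp) (cone_smul_mem hvβ hq)
  · right
    refine ⟨N, rfl, ?_⟩
    rw [hvx, mul_assoc]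
    have : v * (x * sr B α) ∈ Lset B Δ ((N + 1 - k) + k') := by
      rw [Lset, pow_add]
      exact Set.mul_mem_mul hv (hDL _ h)
    exact Lset_mono B Δ (by omega) this

theorem pos_or_neg_aux {B : LinearMap.BilinForm ℝ V} {Δ : Set V}
    (hb : IsBasedRootSystem B Δ) (n : ℕ) : ∀ w ∈ Lset B Δ n, ∀ α ∈ Δ,
      w α ∈ cone Δ ∨ -(w α) ∈ cone Δ := by
  induction n using Nat.strong_induction_on with
  | _ n ih =>
  intro w hw α hα
  rcases main_claim hb n w hw α hα with h | ⟨n', h, h'⟩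
  · exact Or.inl h
  · have := ih n' (by omega) _ h' α hα
    rw [LinearEquiv.mul_apply, sr_self hb.symm (hb.diag_one α hα), map_neg, neg_neg] at this
    exact this.symm

theorem root_smul {B : LinearMap.BilinForm ℝ V} {Δ : Set V} {w : V ≃ₗ[ℝ] V}
    (hw : w ∈ weylGroup B Δ) {β : V} (hβ : β ∈ rootSystem B Δ) : w β ∈ rootSystem B Δ := by
  obtain ⟨u, hu, α, hα, rfl⟩ := hβ
  exact ⟨w * u, mul_mem hw hu, α, hα, rfl⟩

theorem root_neg {B : LinearMap.BilinForm ℝ V} {Δ : Set V}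
    (hb : IsBasedRootSystem B Δ) {β : V} (hβ : β ∈ rootSystem B Δ) : -β ∈ rootSystem B Δ := by
  obtain ⟨u, hu, α, hα, rfl⟩ := hβ
  exact ⟨u * sr B α, mul_mem hu (sr_mem_weyl hb hα), α, hα, by
    rw [LinearEquiv.mul_apply, sr_self hb.symm (hb.diag_one α hα), map_neg]⟩

theorem simple_root {B : LinearMap.BilinForm ℝ V} {Δ : Set V} {α : V} (hα : α ∈ Δ) :
    α ∈ rootSystem B Δ := ⟨1, one_mem _, α, hα, rfl⟩

theorem simple_pos {B : LinearMap.BilinForm ℝ V} {Δ : Set V} {α : V} (hα : α ∈ Δ) :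
    α ∈ positiveRoots B Δ := ⟨simple_root hα, subset_cone _ hα⟩

theorem pos_or_neg {B : LinearMap.BilinForm ℝ V} {Δ : Set V}
    (hb : IsBasedRootSystem B Δ) {β : V} (hβ : β ∈ rootSystem B Δ) :
    β ∈ positiveRoots B Δ ∨ -β ∈ positiveRoots B Δ := by
  have hn := root_neg hb hβ
  obtain ⟨u, hu, α, hα, rfl⟩ := id hβ
  obtain ⟨n, hn'⟩ := exists_Lset hb hu
  exact (pos_or_neg_aux hb n u hn' α hα).imp (fun h => ⟨hβ, h⟩) (fun h => ⟨hn, h⟩)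

theorem root_norm {B : LinearMap.BilinForm ℝ V} {Δ : Set V}
    (hb : IsBasedRootSystem B Δ) {β : V} (hβ : β ∈ rootSystem B Δ) : B β β = 1 := by
  obtain ⟨w, hw, α, hα, rfl⟩ := hβ
  have : ∀ u v, B (w u) (w v) = B u v := by
    refine weyl_induction hb (fun w => ∀ u v, B (w u) (w v) = B u v) (by simp) ?_ hw
    intro w h α hα u v
    rw [LinearEquiv.mul_apply, LinearEquiv.mul_apply, h, sr_isom hb.symm (hb.diag_one α hα)]
  rw [this, hb.diag_one α hα]

theorem pos_asymm {B : LinearMap.BilinForm ℝ V} {Δ : Set V}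
    (hb : IsBasedRootSystem B Δ) {β : V} (hβ : β ∈ positiveRoots B Δ) :
    -β ∉ positiveRoots B Δ := by
  intro h
  have h0 := cone_salient hb.finite hb.indep hβ.2 h.2
  have := root_norm hb hβ.1
  rw [h0] at this
  simp at this

theorem sr_pos {B : LinearMap.BilinForm ℝ V} {Δ : Set V}
    (hb : IsBasedRootSystem B Δ) {α : V} (hα : α ∈ Δ) {β : V} (hβ : β ∈ positiveRoots B Δ)
    (hne : β ≠ α) : sr B α β ∈ positiveRoots B Δ := by
  have ha := hb.diag_one α hα
  rcases pos_or_neg hb (root_smul (sr_mem_weyl hb hα) hβ.1) with h | h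
  · exact h
  exfalso
  obtain ⟨f, hf⟩ := exists_dual hb.indep
  have hz : ∀ γ ∈ Δ, γ ≠ α → f γ β = 0 := by
    intro γ hγ hγα
    have h1 := dual_nonneg hf hβ.2 hγ
    have h2 := dual_nonneg hf h.2 hγ
    rw [sr_apply hb.symm ha, map_neg, map_sub, map_smul, (hf γ hγ).2 α hα hγα.symm] at h2
    simp at h2
    linarith
  have hβe : β = f α β • α := by
    have h3 := dual_sum hb.finite hf (cone_sub_span _ hβ.2)
    rwa [Finset.sum_eq_single α] at h3
    · intro γ hγ hγα
      rw [hz γ (by simpa using hγ) hγα, zero_smul]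
    · intro h; simp [hα] at h
  have h1 := root_norm hb hβ.1
  rw [hβe] at h1
  simp only [map_smul, LinearMap.smul_apply, ha, smul_eq_mul, mul_one] at h1
  have h2 := dual_nonneg hf hβ.2 hα
  have h3 : f α β = 1 := by nlinarith
  rw [h3, one_smul] at hβe
  exact hne hβe

theorem weyl_fix {B : LinearMap.BilinForm ℝ V} {Δ : Set V}
    (hb : IsBasedRootSystem B Δ) {w : V ≃ₗ[ℝ] V} (hw : w ∈ weylGroup B Δ)
    (h : ∀ β ∈ positiveRoots B Δ, w β ∈ positiveRoots B Δ) : w = 1 := by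
  obtain ⟨n, hn⟩ := exists_Lset hb hw
  clear hw
  induction n using Nat.strong_induction_on with
  | _ n ih =>
  rcases n with _ | N
  · simpa [Lset] using hn
  have hn' := hn
  rw [Lset, pow_succ] at hn'
  obtain ⟨u, hu, g, hg, hug⟩ := Set.mem_mul.1 hn'
  rcases hg with rfl | ⟨β, hβ, rfl⟩
  · rw [mul_one] at hug
    subst hug
    exact ih N (by omega) hu
  · have hpos := h β (simple_pos hβ)
    rcases main_claim hb N u hu β hβ with h1 | ⟨n', h1, h2⟩
    · exfalso
      rw [← hug, LinearEquiv.mul_apply, sr_self hb.symm (hb.diag_one β hβ), map_neg] at hpos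
      refine pos_asymm hb hpos ⟨?_, by rwa [neg_neg]⟩
      exact root_neg hb hpos.1
    · rw [hug] at h2
      exact ih n' (by omega) h2

/-! ### Topes -/

theorem tope_iff {E : Set V} {d : Set V → Set V} (h : IsOrientedMatroidOn E d) (R : Set V) :
    IsTope E d R ↔ R ⊆ E ∧ d R ⊆ R ∧ (∀ x ∈ R, -x ∉ R) ∧ ∀ x ∈ E, x ∈ R ∨ -x ∈ R := by
  constructor
  · rintro ⟨hE, hd, has, hmax⟩
    refine ⟨hE, hd, has, ?_⟩
    have hdR : d R = R := subset_antisymm hd (h.le_cx R hE)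
    intro x hx
    by_contra hcon
    push Not at hcon
    obtain ⟨hxR, hnx⟩ := hcon
    have hRx : R ∪ {x} ⊆ E := Set.union_subset hE (by simpa using hx)
    have hRxd := h.le_cx _ hRx
    have hdE := h.cx_le_ground _ hRx
    -- if `z` is in the closure and not in `R`, exchange
    have ex : ∀ z ∈ d (R ∪ {x}), z ∉ R → -x ∈ d (R ∪ {-z}) := by
      intro z hz hzR
      have := h.exchange3 R hE z (hdE hz) (-x) (h.neg_mem x hx) (by simpa using hz)
        (by rwa [hdR])
      rwa [Set.sdiff_singleton_eq_self hnx] at this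
    by_cases hsym : ∀ z ∈ d (R ∪ {x}), -z ∉ d (R ∪ {x})
    · have := hmax (d (R ∪ {x})) hdE (h.cx_idem _ hRx).subset hsym
        (Set.subset_union_left.trans hRxd)
      exact hxR (this ▸ hRxd (Or.inr rfl))
    · push Not at hsym
      obtain ⟨z, hz, hnz⟩ := hsym
      have hfin : ∀ z ∈ d (R ∪ {x}), -z ∈ d (R ∪ {x}) → z ∉ R → False := by
        intro z hz hnz hzR
        have h1 := ex z hz hzR
        have h2 : d (R ∪ {-z}) ⊆ d (R ∪ {x}) := by
          rw [← h.cx_idem _ hRx]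
          refine h.cx_mono _ _ ?_ hdE
          exact Set.union_subset (Set.subset_union_left.trans hRxd) (by simpa using hnz)
        have h3 := h.exchange2 R hE (-x) (h.neg_mem x hx) (by simpa using h2 h1)
        rw [hdR] at h3
        exact hnx h3
      by_cases hzR : z ∈ R
      · exact hfin (-z) hnz (by simpa using hz) (has z hzR)
      · exact hfin z hz hnz hzR
  · rintro ⟨hE, hd, has, hfull⟩
    refine ⟨hE, hd, has, fun R' hE' _ has' hsub => ?_⟩
    refine subset_antisymm (fun x hx => ?_) hsub
    rcases hfull x (hE' hx) with h | h
    · exact h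
    · exact absurd (hsub h) (has' x hx)

theorem image_tope {B : LinearMap.BilinForm ℝ V} {Δ : Set V} {d : Set V → Set V}
    (hd : IsOMRS B Δ d) {R : Set V} (hR : IsTope (rootSystem B Δ) d R) {w : V ≃ₗ[ℝ] V}
    (hw : w ∈ weylGroup B Δ) : IsTope (rootSystem B Δ) d (⇑w '' R) := by
  rw [tope_iff hd.om] at hR ⊢
  obtain ⟨hE, hdR, has, hfull⟩ := hR
  have hmem : ∀ x, x ∈ ⇑w '' R ↔ w⁻¹ x ∈ R := by
    intro x
    constructor
    · rintro ⟨y, hy, rfl⟩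
      simpa [← LinearEquiv.mul_apply] using hy
    · intro h
      exact ⟨_, h, by simp [← LinearEquiv.mul_apply]⟩
  refine ⟨?_, ?_, ?_, ?_⟩
  · rintro _ ⟨y, hy, rfl⟩
    exact root_smul hw (hE hy)
  · rw [hd.equivariant w hw R hE]
    exact Set.image_mono hdR
  · intro x hx
    rw [hmem] at hx ⊢
    rw [map_neg]
    exact has _ hx
  · intro x hx
    rw [hmem, hmem, map_neg]
    exact hfull _ (root_smul (inv_mem hw) hx)

theorem pos_tope {B : LinearMap.BilinForm ℝ V} {Δ : Set V} {d : Set V → Set V}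
    (hb : IsBasedRootSystem B Δ) (hd : IsOMRS B Δ d) :
    IsTope (rootSystem B Δ) d (positiveRoots B Δ) := by
  rw [tope_iff hd.om]
  exact ⟨fun x hx => hx.1, hd.positive_closed.subset, fun x hx => pos_asymm hb hx,
    fun x hx => pos_or_neg hb hx⟩

/-- A closed set containing the simple roots contains all the positive roots. -/
theorem pos_sub_of_simple {B : LinearMap.BilinForm ℝ V} {Δ : Set V} {d : Set V → Set V}
    (hb : IsBasedRootSystem B Δ) (hfin : (rootSystem B Δ).Finite) (hd : IsOMRS B Δ d)
    {R : Set V} (hE : R ⊆ rootSystem B Δ) (hdR : d R ⊆ R) (hΔ : Δ ⊆ R) :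
    positiveRoots B Δ ⊆ R := by
  obtain ⟨f, hf⟩ := exists_dual hb.indep
  let ht : V → ℝ := fun v => ∑ α ∈ hb.finite.toFinset, f α v
  have hht : ∀ α ∈ Δ, ht α = 1 := by
    intro α hα
    simp only [ht]
    rw [Finset.sum_eq_single α, (hf α hα).1]
    · intro γ hγ hγα
      exact (hf γ (by simpa using hγ)).2 α hα hγα.symm
    · intro h; simp [hα] at h
  by_contra hcon
  rw [Set.not_subset] at hcon
  have hfin' : (positiveRoots B Δ \ R).Finite := hfin.subset fun x hx => hx.1.1
  obtain ⟨β, ⟨hβ, hβR⟩, hmin⟩ := Set.exists_min_image _ ht hfin'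
    (by obtain ⟨a, h1, h2⟩ := hcon; exact ⟨a, h1, h2⟩)
  -- a simple root with positive pairing
  obtain ⟨α, hα, hpos⟩ : ∃ α ∈ Δ, 0 < B β α := by
    by_contra hno
    push Not at hno
    have h1 := root_norm hb hβ.1
    have h2 : B β β = ∑ α ∈ hb.finite.toFinset, f α β * B β α := by
      conv_lhs => rw [dual_sum hb.finite hf (cone_sub_span _ hβ.2)]
      rw [← dual_sum hb.finite hf (cone_sub_span _ hβ.2)]
      conv_lhs => enter [2]; rw [dual_sum hb.finite hf (cone_sub_span _ hβ.2)]
      simp [map_sum]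
    have h3 : ∑ α ∈ hb.finite.toFinset, f α β * B β α ≤ 0 := by
      refine Finset.sum_nonpos fun γ hγ => ?_
      have hγ : γ ∈ Δ := by simpa using hγ
      exact mul_nonpos_of_nonneg_of_nonpos (dual_nonneg hf hβ.2 hγ) (hno γ hγ)
    linarith
  have hβα : β ≠ α := fun h => hβR (h ▸ hΔ hα)
  have hγ := sr_pos hb hα hβ hβα
  set γ := sr B α β with hγdef
  have hγe : γ = β - (2 * B β α) • α := sr_apply hb.symm (hb.diag_one α hα) β
  have hγR : γ ∈ R := by
    by_contra hγR
    have h1 := hmin γ ⟨hγ, hγR⟩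
    have h2 : ht γ = ht β - (2 * B β α) * ht α := by
      simp only [ht, hγe, map_sub, map_smul, smul_eq_mul, Finset.sum_sub_distrib, Finset.mul_sum]
    rw [hht α hα] at h2
    linarith
  have hsub : ({α, γ} : Set V) ⊆ R := by
    rintro x (rfl | rfl)
    · exact hΔ hα
    · exact hγR
  apply hβR
  apply hdR
  apply hd.om.cx_mono _ _ hsub hE
  rw [hd.rank_two _ (hsub.trans hE)]
  · refine ⟨?_, hβ.1⟩
    have : β = (2 * B β α) • α + γ := by rw [hγe]; abel
    rw [this]
    exact cone_add_mem (cone_smul_mem (subset_cone _ (by simp)) (by linarith)) (subset_cone _ (by simp))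
  · refine (rank_span_le _).trans ?_
    refine Cardinal.mk_insert_le.trans ?_
    rw [Cardinal.mk_singleton]
    norm_num

theorem tope_eq {B : LinearMap.BilinForm ℝ V} {Δ : Set V} {d : Set V → Set V}
    (hb : IsBasedRootSystem B Δ) (hfin : (rootSystem B Δ).Finite) (hd : IsOMRS B Δ d)
    (n : ℕ) : ∀ R : Set V, IsTope (rootSystem B Δ) d R → (positiveRoots B Δ \ R).ncard = n →
      ∃ w ∈ weylGroup B Δ, R = ⇑w '' positiveRoots B Δ := by
  induction n using Nat.strong_induction_on with
  | _ n ih =>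
  intro R hR hn
  have hR' := (tope_iff hd.om R).1 hR
  by_cases hΔ : Δ ⊆ R
  · refine ⟨1, one_mem _, ?_⟩
    have := (pos_tope hb hd).2.2.2 R hR.1 hR.2.1 hR.2.2.1
      (pos_sub_of_simple hb hfin hd hR.1 hR.2.1 hΔ)
    rw [this]
    simp
  · rw [Set.not_subset] at hΔ
    obtain ⟨α, hα, hαR⟩ := hΔ
    have hnα : -α ∈ R := (hR'.2.2.2 α (simple_root hα)).resolve_left hαR
    have hsw := sr_mem_weyl hb hα
    have ha := hb.diag_one α hα
    have hss : ∀ v, sr B α (sr B α v) = v := fun v => by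
      rw [← LinearEquiv.mul_apply, sr_mul_self hb.symm ha]; rfl
    have hfinR : (positiveRoots B Δ \ R).Finite := hfin.subset fun x hx => hx.1.1
    have hlt : (positiveRoots B Δ \ (⇑(sr B α) '' R)).ncard < n := by
      rw [← hn, ← Set.ncard_image_of_injective _ (sr B α).injective]
      refine Set.ncard_lt_ncard ?_ hfinR
      rw [Set.ssubset_iff_of_subset]
      · refine ⟨α, ⟨simple_pos hα, hαR⟩, ?_⟩
        rintro ⟨β, ⟨hβ, _⟩, hβα⟩
        have : β = -α := by rw [← hss β, hβα, sr_self hb.symm ha]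
        rw [this] at hβ
        exact pos_asymm hb (simple_pos hα) hβ
      · rintro _ ⟨β, ⟨hβ, hβR⟩, rfl⟩
        refine ⟨sr_pos hb hα hβ ?_, fun h => hβR ⟨_, h, hss β⟩⟩
        rintro rfl
        exact hβR ⟨-β, hnα, by rw [map_neg, sr_self hb.symm ha, neg_neg]⟩
    obtain ⟨w, hw, h⟩ := ih _ hlt _ (image_tope hd hR hsw) rfl
    refine ⟨sr B α * w, mul_mem hsw hw, ?_⟩
    have : R = ⇑(sr B α) '' (⇑(sr B α) '' R) := by
      rw [Set.image_image]; simp [hss]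
    rw [this, h, Set.image_image]
    rfl

/-- for a finite based root system, the topes of any OMRS are exactly the
sets `w·Φ⁺` for `w ∈ W`; these are pairwise distinct, so there are exactly `|W|` topes. -/
theorem finite_OMRS_topes [FiniteDimensional ℝ V]
    (B : LinearMap.BilinForm ℝ V) (Δ : Set V)
    (hbrs : IsBasedRootSystem B Δ) (hfin : (rootSystem B Δ).Finite)
    (d : Set V → Set V) (hd : IsOMRS B Δ d) :
    (∀ R : Set V, IsTope (rootSystem B Δ) d R ↔
        ∃ w ∈ weylGroup B Δ, R = ⇑w '' positiveRoots B Δ) ∧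
      (∀ w ∈ weylGroup B Δ, ∀ w' ∈ weylGroup B Δ,
        ⇑w '' positiveRoots B Δ = ⇑w' '' positiveRoots B Δ → w = w') ∧
      {R : Set V | IsTope (rootSystem B Δ) d R}.ncard = Nat.card (weylGroup B Δ) := by
  have h1 : ∀ R : Set V, IsTope (rootSystem B Δ) d R ↔
      ∃ w ∈ weylGroup B Δ, R = ⇑w '' positiveRoots B Δ := by
    intro R
    constructor
    · intro hR
      exact tope_eq hbrs hfin hd _ R hR rfl
    · rintro ⟨w, hw, rfl⟩
      exact image_tope hd (pos_tope hbrs hd) hw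
  have h2 : ∀ w ∈ weylGroup B Δ, ∀ w' ∈ weylGroup B Δ,
      ⇑w '' positiveRoots B Δ = ⇑w' '' positiveRoots B Δ → w = w' := by
    intro w hw w' hw' h
    have : w'⁻¹ * w = 1 := by
      refine weyl_fix hbrs (mul_mem (inv_mem hw') hw) fun β hβ => ?_
      have hm : w β ∈ ⇑w' '' positiveRoots B Δ := h ▸ ⟨β, hβ, rfl⟩
      obtain ⟨γ, hγ, he⟩ := hm
      rw [LinearEquiv.mul_apply, ← he, ← LinearEquiv.mul_apply, inv_mul_cancel]
      exact hγ
    exact (inv_mul_eq_one.1 this).symm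
  refine ⟨h1, h2, ?_⟩
  rw [← Nat.card_coe_set_eq]
  refine (Nat.card_congr (Equiv.ofBijective
    (fun w : weylGroup B Δ => (⟨⇑(w : V ≃ₗ[ℝ] V) '' positiveRoots B Δ,
      (h1 _).2 ⟨w, w.2, rfl⟩⟩ : {R : Set V | IsTope (rootSystem B Δ) d R})) ⟨?_, ?_⟩)).symm
  · intro w w' h
    exact Subtype.ext (h2 w w.2 w' w'.2 (congrArg Subtype.val h))
  · rintro ⟨R, hR⟩
    obtain ⟨w, hw, rfl⟩ := (h1 R).1 hR
    exact ⟨⟨w, hw⟩, rfl⟩
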